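/- Let G = ⟨a,b_1,…,b_r⟩ be a multi-GGS-group. Then the level-(r+1) stabilizer is contained in the commutator subgroup: st_G(r+1) ≤ G′. -/

import Mathlib

/-!
Automorphisms of the `p`-regular rooted tree, encoded by portraits:
an automorphism is a family of permutations of `Fin p`, one for each vertex
(vertices are finite words over `Fin p`, the root being `[]`).
-/

namespace TreeAut

variable {p : ℕ}

/-- Automorphisms of the `p`-regular rooted tree, given by their portraits. -/
def AutT (p : ℕ) : Type := List (Fin p) → Equiv.Perm (Fin p)

namespace AutT

/-- The action of a tree automorphism on the vertices (finite words over `Fin p`). -/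
def act : AutT p → List (Fin p) → List (Fin p)
  | _, [] => []
  | f, x :: w => f [] x :: act (fun v => f (x :: v)) w

/-- The section of `f` at the level-one vertex `x`; the map
`f ↦ (sections f 0, …, sections f (p-1))` restricted to the first-level
stabilizer is the isomorphism `ψ`. -/
def sections (f : AutT p) : Fin p → AutT p := fun x v => f (x :: v)

instance : One (AutT p) := ⟨fun _ => 1⟩

instance : Mul (AutT p) := ⟨fun f g v => f (act g v) * g v⟩

/-- The action of the inverse automorphism on vertices. -/
def invAct : AutT p → List (Fin p) → List (Fin p)
  | _, [] => []
  | f, x :: w => (f [])⁻¹ x :: invAct (fun v => f (((f [])⁻¹ x) :: v)) w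

instance : Inv (AutT p) := ⟨fun f v => (f (invAct f v))⁻¹⟩

lemma one_apply (v : List (Fin p)) : (1 : AutT p) v = 1 := rfl

lemma mul_apply (f g : AutT p) (v : List (Fin p)) : (f * g) v = f (act g v) * g v := rfl

lemma inv_apply (f : AutT p) (v : List (Fin p)) : f⁻¹ v = (f (invAct f v))⁻¹ := rfl

lemma act_nil (f : AutT p) : act f [] = [] := rfl

lemma act_cons (f : AutT p) (x : Fin p) (w : List (Fin p)) :
    act f (x :: w) = f [] x :: act (sections f x) w := rfl

lemma sections_mul (f g : AutT p) (x : Fin p) :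
    sections (f * g) x = sections f (g [] x) * sections g x :=
  funext fun _ => rfl

lemma act_one : ∀ v : List (Fin p), act (1 : AutT p) v = v
  | [] => rfl
  | x :: w => congrArg (x :: ·) (act_one w)

lemma act_mul (f g : AutT p) : ∀ v : List (Fin p), act (f * g) v = act f (act g v)
  | [] => rfl
  | x :: w => by
      rw [act_cons (f * g), sections_mul, act_mul, act_cons g, act_cons f]
      rfl

lemma invAct_act (f : AutT p) : ∀ v : List (Fin p), invAct f (act f v) = v
  | [] => rfl
  | x :: w => by
      rw [act_cons]
      show (f [])⁻¹ (f [] x) ::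
          invAct (fun v => f (((f [])⁻¹ (f [] x)) :: v)) (act (sections f x) w) = x :: w
      have h : (f [])⁻¹ (f [] x) = x := Equiv.symm_apply_apply (f []) x
      refine (congrArg (fun y => y :: invAct (fun v => f (y :: v)) (act (sections f x) w)) h).trans ?_
      exact congrArg (x :: ·) (invAct_act (sections f x) w)

instance : Group (AutT p) where
  mul_assoc f g h := by
    funext v
    show (f * g) (act h v) * h v = f (act (g * h) v) * (g * h) v
    rw [mul_apply, mul_apply, act_mul, mul_assoc]
  one_mul f := by
    funext v
    show (1 : AutT p) (act f v) * f v = f v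
    rw [one_apply, one_mul]
  mul_one f := by
    funext v
    show f (act (1 : AutT p) v) * (1 : AutT p) v = f v
    rw [act_one, one_apply, mul_one]
  inv_mul_cancel f := by
    funext v
    show f⁻¹ (act f v) * f v = (1 : AutT p) v
    rw [inv_apply, invAct_act, one_apply, inv_mul_cancel]

lemma act_length (f : AutT p) : ∀ v : List (Fin p), (act f v).length = v.length
  | [] => rfl
  | _ :: w => congrArg Nat.succ (act_length _ w)

lemma act_act_inv (f : AutT p) (v : List (Fin p)) : act f (act f⁻¹ v) = v := by
  rw [← act_mul, mul_inv_cancel, act_one]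

/-- The pointwise stabilizer `st(n)` of the `n`-th level of the tree. -/
def levelStab (p n : ℕ) : Subgroup (AutT p) where
  carrier := {f | ∀ v : List (Fin p), v.length = n → act f v = v}
  one_mem' := fun v _ => act_one v
  mul_mem' := by
    intro f g hf hg v hv
    rw [act_mul, hg v hv, hf v hv]
  inv_mem' := by
    intro f hf v hv
    have h1 : act f (act f⁻¹ v) = v := act_act_inv f v
    have h2 : act f (act f⁻¹ v) = act f⁻¹ v := hf _ (by rw [act_length, hv])
    exact h2.symm.trans h1

instance levelStab_normal (p n : ℕ) : (levelStab p n).Normal := by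
  constructor
  intro f hf g v hv
  show act (g * f * g⁻¹) v = v
  rw [act_mul, act_mul, hf _ (by rw [act_length, hv]), act_act_inv]

/-- The tuple of sections at the level-two vertices.  Restricted to the
second-level stabilizer this is the map `ψ₂`. -/
def sections2 (f : AutT p) : Fin p → Fin p → AutT p := fun x y v => f (x :: y :: v)

/-- The rooted automorphism defined by a permutation `σ` of `Fin p`. -/
def rooted (σ : Equiv.Perm (Fin p)) : AutT p := fun v => if v = [] then σ else 1

/-- The rooted automorphism `a`, acting at the root by the cycle `(1 2 … p)`. -/
def rootedA (p : ℕ) : AutT p := rooted (finRotate p)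

/-- Auxiliary portrait for the directed automorphism `b_e`. -/
def directedAux (e : Fin (p - 1) → ZMod p) : List (Fin p) → Equiv.Perm (Fin p)
  | [] => 1
  | x :: w =>
      if h : (x : ℕ) < p - 1 then
        (if w = [] then finRotate p ^ ((e ⟨x, h⟩).val) else 1)
      else directedAux e w

/-- The directed automorphism `b_e` defined by the vector `e ∈ 𝔽_p^{p-1}`,
i.e. the unique automorphism with `ψ(b_e) = (a^{e_1}, …, a^{e_{p-1}}, b_e)`. -/
def directed (e : Fin (p - 1) → ZMod p) : AutT p := directedAux e

/-- The multi-GGS-group determined by the vectors `e 1, …, e r`. -/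
def multiGGS (p : ℕ) {r : ℕ} (e : Fin r → Fin (p - 1) → ZMod p) : Subgroup (AutT p) :=
  Subgroup.closure ({rootedA p} ∪ Set.range fun i => directed (e i))

/-- The GGS-group `𝒢` defined by the (nonzero) constant vector `(c, …, c)`. -/
def constGGS (p : ℕ) (c : ZMod p) : Subgroup (AutT p) :=
  Subgroup.closure {rootedA p, directed (fun _ => c)}

/-- `G` is the GGS-group `𝒢` defined by a constant vector. -/
def IsConstGGS {p : ℕ} (G : Subgroup (AutT p)) : Prop :=
  ∃ c : ZMod p, c ≠ 0 ∧ G = constGGS p c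

/-- The stabilizer `st_G(n) = G ∩ st(n)`, viewed as a subgroup of `G`. -/
def stabIn {p : ℕ} (G : Subgroup (AutT p)) (n : ℕ) : Subgroup G :=
  (levelStab p n).comap G.subtype

instance {p : ℕ} (G : Subgroup (AutT p)) (n : ℕ) : (stabIn G n).Normal :=
  Subgroup.Normal.comap (levelStab_normal p n) G.subtype

/-- The congruence subgroup property: every finite-index subgroup of `G`
contains a level stabilizer `st_G(n)`. -/
def HasCSP {p : ℕ} (G : Subgroup (AutT p)) : Prop :=
  ∀ H : Subgroup G, H.FiniteIndex → ∃ n : ℕ, stabIn G n ≤ H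

/-- `G` is just infinite: it is infinite and all its nontrivial normal
subgroups have finite index. -/
def JustInfinite {p : ℕ} (G : Subgroup (AutT p)) : Prop :=
  Infinite G ∧ ∀ N : Subgroup G, N.Normal → N ≠ ⊥ → N.FiniteIndex

end AutT

end TreeAut

namespace TreeAut

namespace AutT

open Multiplicative

section LinearAlgebra

variable {p : ℕ} [Fact p.Prime] {M W : Type*} [AddCommGroup M] [Module (ZMod p) M]
  [AddCommGroup W] [Module (ZMod p) W]

/-- In characteristic `p`, an operator `T` with `T ^ p = 1` is unipotent. -/
lemma sub_one_pow_eq_zero (T : Module.End (ZMod p) M) (hT : T ^ p = 1) : (T - 1) ^ p = 0 := by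
  have h : ((Polynomial.X - 1 : Polynomial (ZMod p)) ^ p) = Polynomial.X ^ p - 1 := by
    rw [sub_pow_char, one_pow]
  simpa [hT] using congrArg (Polynomial.aeval T) h

/-- Let `T ^ p = 1` and let `E` be injective. If `x 0, …, x (p - 1)` lie in `V ≠ 0` and
`∑ T ^ k (E (x k)) = 0`, then `∑ x k` lies in a proper subspace of `V` depending only on `V`. -/
lemma exists_lt_forall_sum_mem (T : Module.End (ZMod p) M) (hT : T ^ p = 1)
    (E : W →ₗ[ZMod p] M) (hE : Function.Injective E) (V : Submodule (ZMod p) W) (hV : V ≠ ⊥) :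
    ∃ U < V, ∀ x : Fin p → W, (∀ k, x k ∈ V) →
      ∑ k : Fin p, (T ^ (k : ℕ)) (E (x k)) = 0 → ∑ k, x k ∈ U := by
  classical
  obtain ⟨D, hD⟩ : ∃ D : Module.End (ZMod p) M, D = T - 1 := ⟨_, rfl⟩
  have hex : ∃ m, ∀ v ∈ V, (D ^ m) (E v) = 0 :=
    ⟨p, fun v _ => by rw [hD, sub_one_pow_eq_zero T hT]; rfl⟩
  obtain ⟨m, hm, hmin⟩ : ∃ m, (∀ v ∈ V, (D ^ (m + 1)) (E v) = 0) ∧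
      ∃ v ∈ V, (D ^ m) (E v) ≠ 0 := by
    obtain ⟨n, hn⟩ : ∃ n, n = Nat.find hex := ⟨_, rfl⟩
    have hspec := Nat.find_spec hex
    rw [← hn] at hspec
    cases n with
    | zero =>
      refine absurd ((Submodule.eq_bot_iff V).2 fun v hv => hE ?_) hV
      simpa using hspec v hv
    | succ m =>
      refine ⟨m, hspec, ?_⟩
      have := Nat.find_min hex (m := m) (by omega)
      push Not at this
      exact this
  refine ⟨V ⊓ LinearMap.ker ((D ^ m : Module.End (ZMod p) M) ∘ₗ E), ?_, ?_⟩
  · refine lt_of_le_of_ne inf_le_left fun h => ?_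
    obtain ⟨v, hv, hne⟩ := hmin
    rw [← h] at hv
    exact hne hv.2
  · intro x hx hsum
    refine ⟨V.sum_mem fun k _ => hx k, ?_⟩
    have key : ∀ (k : ℕ), ∀ v ∈ V, (D ^ m) ((T ^ k) (E v)) = (D ^ m) (E v) := by
      intro k v hv
      have hdvd : D ^ m * T ^ k - D ^ m =
          (∑ i ∈ Finset.range k, T ^ i) * D ^ (m + 1) := by
        have hc : Commute D (T ^ k - 1) := hD ▸
          (((Commute.refl T).sub_left (Commute.one_left T)).pow_right k).sub_right
            (Commute.one_right _)
        rw [pow_succ', ← mul_assoc]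
        nth_rw 3 [hD]
        rw [geom_sum_mul, ← (hc.pow_left m).eq, mul_sub, mul_one]
      have := LinearMap.congr_fun hdvd (E v)
      rw [Module.End.mul_apply, hm v hv, map_zero] at this
      exact sub_eq_zero.1 this
    have := congrArg (D ^ m) hsum
    rw [map_sum, map_zero, Finset.sum_congr rfl fun (k : Fin p) _ => key k (x k) (hx k)] at this
    simpa [map_sum] using this

end LinearAlgebra

section PowVal

variable {p : ℕ} {A : Type*} [Group A] {x : A}

lemma pow_val_natCast (hx : x ^ p = 1) (m : ℕ) : x ^ (m : ZMod p).val = x ^ m := by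
  rw [ZMod.val_natCast, ← pow_mod_orderOf, Nat.mod_mod_of_dvd _ (orderOf_dvd_of_pow_eq_one hx),
    pow_mod_orderOf]

variable [NeZero p]

lemma pow_val_add (hx : x ^ p = 1) (c d : ZMod p) :
    x ^ (c + d).val = x ^ c.val * x ^ d.val := by
  rw [← pow_add, ← pow_val_natCast hx (c.val + d.val)]
  simp

lemma pow_val_neg (hx : x ^ p = 1) (c : ZMod p) : x ^ (-c).val = (x ^ c.val)⁻¹ := by
  rw [eq_inv_iff_mul_eq_one, ← pow_val_add hx]
  simp

end PowVal

section Rotation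

variable {p : ℕ}

/-- The rotation of `Fin p` by `c ∈ ℤ/p`. -/
def rot (c : ZMod p) : Equiv.Perm (Fin p) := finRotate p ^ c.val

lemma rot_zero : rot (0 : ZMod p) = 1 := by simp [rot]

variable [NeZero p]

lemma finRotate_pow_apply (m : ℕ) (x : Fin p) : (finRotate p ^ m) x = x + Fin.ofNat p m := by
  obtain ⟨q, rfl⟩ := Nat.exists_eq_succ_of_ne_zero (NeZero.ne p)
  induction m generalizing x with
  | zero => ext; simp [Fin.ofNat]
  | succ m ih =>
    rw [pow_succ, Equiv.Perm.mul_apply, ih, finRotate_apply]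
    ext
    simp [Fin.val_add, Fin.ofNat]
    ring_nf

lemma finRotate_pow_self : finRotate p ^ p = 1 := by
  ext x
  rw [finRotate_pow_apply]
  simp [Fin.ofNat]

lemma rot_apply (c : ZMod p) (x : Fin p) : rot c x = x + Fin.ofNat p c.val :=
  finRotate_pow_apply _ _

lemma rot_natCast (m : ℕ) : rot (m : ZMod p) = finRotate p ^ m :=
  pow_val_natCast finRotate_pow_self m

lemma rot_add (c d : ZMod p) : rot (c + d) = rot c * rot d :=
  pow_val_add finRotate_pow_self c d

lemma rot_neg (c : ZMod p) : rot (-c) = (rot c)⁻¹ :=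
  pow_val_neg finRotate_pow_self c

lemma rot_eq_one_iff {c : ZMod p} : rot c = 1 ↔ c = 0 := by
  refine ⟨fun h => ?_, fun h => h ▸ rot_zero⟩
  have := congrArg (fun σ : Equiv.Perm (Fin p) => (σ 0).val) h
  simpa [rot_apply, Fin.ofNat, Nat.mod_eq_of_lt (ZMod.val_lt c)] using this

end Rotation

section Sections

variable {p : ℕ}

lemma sections_rooted (σ : Equiv.Perm (Fin p)) (x : Fin p) : sections (rooted σ) x = 1 := by
  funext v
  simp [sections, rooted, one_apply]

lemma ext_sections {f g : AutT p} (h : f [] = g []) (hs : ∀ x, sections f x = sections g x) :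
    f = g := by
  funext v
  cases v with
  | nil => exact h
  | cons x w => exact congrFun (hs x) w

lemma rooted_mul (σ τ : Equiv.Perm (Fin p)) : rooted σ * rooted τ = rooted (σ * τ) := by
  refine ext_sections rfl fun x => ?_
  rw [sections_mul]
  simp only [sections_rooted, mul_one]

lemma rooted_one : rooted (1 : Equiv.Perm (Fin p)) = 1 :=
  ext_sections rfl fun x => sections_rooted 1 x

lemma rooted_pow (σ : Equiv.Perm (Fin p)) (n : ℕ) : rooted σ ^ n = rooted (σ ^ n) := by
  induction n with
  | zero => exact rooted_one.symm
  | succ n ih => rw [pow_succ, pow_succ, ih, rooted_mul]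

lemma rootedA_pow_self [NeZero p] : rootedA p ^ p = 1 := by
  rw [rootedA, rooted_pow, finRotate_pow_self, rooted_one]

lemma sections_directed_of_lt (e : Fin (p - 1) → ZMod p) (x : Fin p) (h : (x : ℕ) < p - 1) :
    sections (directed e) x = rootedA p ^ (e ⟨x, h⟩).val := by
  rw [rootedA, rooted_pow]
  funext v
  simp [sections, directed, directedAux, h, rooted]

lemma sections_directed_of_not_lt (e : Fin (p - 1) → ZMod p) (x : Fin p)
    (h : ¬ (x : ℕ) < p - 1) : sections (directed e) x = directed e := by
  funext v
  simp [sections, directed, directedAux, h]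

lemma root_inv (g : AutT p) : g⁻¹ [] = (g [])⁻¹ := rfl

lemma sections_inv (g : AutT p) (x : Fin p) :
    sections g⁻¹ x = (sections g ((g [])⁻¹ x))⁻¹ := by
  rw [eq_inv_iff_mul_eq_one]
  have := sections_mul g⁻¹ g ((g [])⁻¹ x)
  rw [inv_mul_cancel, ← Equiv.Perm.mul_apply, mul_inv_cancel, Equiv.Perm.one_apply] at this
  exact this.symm

lemma sections_pow_of_root {g : AutT p} (h : g [] = 1) (n : ℕ) :
    (g ^ n) [] = 1 ∧ ∀ x, sections (g ^ n) x = sections g x ^ n := by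
  induction n with
  | zero => exact ⟨rfl, fun _ => rfl⟩
  | succ n ih =>
    refine ⟨?_, fun x => ?_⟩
    · rw [pow_succ, mul_apply, act_nil, ih.1, h, one_mul]
    · rw [pow_succ, sections_mul, h, Equiv.Perm.one_apply, ih.2, pow_succ]

lemma directed_pow_self [NeZero p] (e : Fin (p - 1) → ZMod p) : directed e ^ p = 1 := by
  have hroot : directed e [] = 1 := rfl
  funext v
  induction v with
  | nil => exact (sections_pow_of_root hroot p).1
  | cons x w ih =>
    change sections (directed e ^ p) x w = 1
    rw [(sections_pow_of_root hroot p).2]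
    by_cases h : (x : ℕ) < p - 1
    · rw [sections_directed_of_lt e x h, ← pow_mul, mul_comm, pow_mul, rootedA_pow_self, one_pow]
      rfl
    · rw [sections_directed_of_not_lt e x h, ih]
      rfl

lemma sections_mem_levelStab {n : ℕ} {g : AutT p} (hg : g ∈ levelStab p (n + 1)) (x : Fin p) :
    sections g x ∈ levelStab p n := by
  intro v hv
  have := hg (x :: v) (by simp [hv])
  rw [act_cons] at this
  exact (List.cons.inj this).2

lemma root_eq_one_of_mem_levelStab {n : ℕ} {g : AutT p} (hg : g ∈ levelStab p (n + 1)) :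
    g [] = 1 := by
  ext x
  have := hg (x :: List.replicate n x) (by simp)
  rw [act_cons] at this
  exact congrArg Fin.val (List.cons.inj this).1

end Sections

section Exponents

variable {p r : ℕ}

/-- The relation between elements of a multi-GGS-group and the exponent vectors, modulo `p`, of
the directed generators in words representing them. -/
def exponentRel (e : Fin r → Fin (p - 1) → ZMod p) :
    Subgroup (AutT p × Multiplicative (Fin r → ZMod p)) :=
  Subgroup.closure ({(rootedA p, 1)} ∪
    Set.range fun i => (directed (e i), ofAdd (Pi.single i 1)))

variable {e : Fin r → Fin (p - 1) → ZMod p}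

lemma rootedA_mem_exponentRel : (rootedA p, ofAdd 0) ∈ exponentRel e :=
  Subgroup.subset_closure (Or.inl rfl)

lemma directed_mem_exponentRel (i : Fin r) :
    (directed (e i), ofAdd (Pi.single i 1)) ∈ exponentRel e :=
  Subgroup.subset_closure (Or.inr ⟨i, rfl⟩)

lemma one_mem_exponentRel : ((1 : AutT p), ofAdd 0) ∈ exponentRel e :=
  (exponentRel e).one_mem

lemma mul_mem_exponentRel {g h : AutT p} {s t : Fin r → ZMod p}
    (hg : (g, ofAdd s) ∈ exponentRel e) (hh : (h, ofAdd t) ∈ exponentRel e) :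
    (g * h, ofAdd (s + t)) ∈ exponentRel e :=
  (exponentRel e).mul_mem hg hh

lemma inv_mem_exponentRel {g : AutT p} {s : Fin r → ZMod p}
    (hg : (g, ofAdd s) ∈ exponentRel e) : (g⁻¹, ofAdd (-s)) ∈ exponentRel e :=
  (exponentRel e).inv_mem hg

lemma rootedA_pow_mem_exponentRel (n : ℕ) : (rootedA p ^ n, ofAdd 0) ∈ exponentRel e := by
  simpa using (exponentRel e).pow_mem rootedA_mem_exponentRel n

/-- Every element of a multi-GGS-group has an exponent vector. -/
lemma exists_mem_exponentRel {g : AutT p} (hg : g ∈ multiGGS p e) :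
    ∃ s, (g, ofAdd s) ∈ exponentRel e := by
  induction hg using Subgroup.closure_induction with
  | mem g hg =>
    rcases hg with rfl | ⟨i, rfl⟩
    · exact ⟨0, rootedA_mem_exponentRel⟩
    · exact ⟨_, directed_mem_exponentRel i⟩
  | one => exact ⟨0, one_mem_exponentRel⟩
  | mul g h _ _ hg hh =>
    obtain ⟨s, hs⟩ := hg
    obtain ⟨t, ht⟩ := hh
    exact ⟨_, mul_mem_exponentRel hs ht⟩
  | inv g _ hg =>
    obtain ⟨s, hs⟩ := hg
    exact ⟨_, inv_mem_exponentRel hs⟩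

/-- The defining vector `(e_1, …, e_{p-1})`, extended to `(0, e_1, …, e_{p-1})`. -/
def extendZero (p : ℕ) : (Fin (p - 1) → ZMod p) →ₗ[ZMod p] (Fin p → ZMod p) where
  toFun f k := if h : 0 < (k : ℕ) then f ⟨k - 1, by omega⟩ else 0
  map_add' f g := by ext k; by_cases h : 0 < (k : ℕ) <;> simp [h]
  map_smul' c f := by ext k; by_cases h : 0 < (k : ℕ) <;> simp [h]

lemma extendZero_injective : Function.Injective (extendZero p) := by
  intro f g h
  ext k
  simpa [extendZero] using congrFun h ⟨k + 1, by omega⟩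

/-- The linear combinations of the extended defining vectors. -/
noncomputable def vectorComb (e : Fin r → Fin (p - 1) → ZMod p) :
    (Fin r → ZMod p) →ₗ[ZMod p] (Fin p → ZMod p) :=
  extendZero p ∘ₗ Fintype.linearCombination (ZMod p) e

lemma vectorComb_injective (he : LinearIndependent (ZMod p) e) :
    Function.Injective (vectorComb e) :=
  extendZero_injective.comp he.fintypeLinearCombination_injective

lemma vectorComb_single (i : Fin r) : vectorComb e (Pi.single i 1) = extendZero p (e i) := by
  simp [vectorComb]

/-- An element with exponent vector `s` acts on the first level as a rotation, its first-level
sections have exponent vectors `x k` that add up to `s`, and the action of these sections on the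
first level is determined by the `x k`. -/
lemma exists_sections_of_mem_exponentRel [NeZero p] {g : AutT p} {s : Fin r → ZMod p}
    (hg : (g, ofAdd s) ∈ exponentRel e) :
    (∃ c : ZMod p, g [] = rot c) ∧ ∃ x : Fin p → Fin r → ZMod p, ∑ k, x k = s ∧
      ∀ k, (sections g k, ofAdd (x k)) ∈ exponentRel e ∧
        sections g k [] = rot (∑ j, vectorComb e (x j) (k - j)) := by
  suffices H : ∀ y ∈ exponentRel e, (∃ c : ZMod p, y.1 [] = rot c) ∧
      ∃ x : Fin p → Fin r → ZMod p, ∑ k, x k = toAdd y.2 ∧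
      ∀ k, (sections y.1 k, ofAdd (x k)) ∈ exponentRel e ∧
        sections y.1 k [] = rot (∑ j, vectorComb e (x j) (k - j)) from H _ hg
  clear hg g s
  have shift : ∀ (x : Fin p → Fin r → ZMod p) (k d : Fin p),
      ∑ j, vectorComb e (x j) (k + d - j) = ∑ j, vectorComb e (x (j + d)) (k - j) := by
    intro x k d
    rw [← Equiv.sum_comp (Equiv.addRight d)]
    refine Finset.sum_congr rfl fun j _ => ?_
    rw [Equiv.coe_addRight, add_sub_add_right_eq_sub]
  intro y hy
  induction hy using Subgroup.closure_induction with
  | mem y hy =>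
    rcases hy with rfl | ⟨i, rfl⟩
    · refine ⟨⟨((1 : ℕ) : ZMod p), ?_⟩, 0, by simp, fun k => ⟨?_, ?_⟩⟩
      · rw [rot_natCast, pow_one]; rfl
      · rw [rootedA, sections_rooted]; exact one_mem_exponentRel
      · simp [rootedA, sections_rooted, rot_zero, one_apply]
    · have hsum : ∀ k : Fin p, ∑ j, vectorComb e ((Pi.single (-1 : Fin p)
          (Pi.single i (1 : ZMod p)) : Fin p → Fin r → ZMod p) j) (k - j)
            = extendZero p (e i) (k + 1) := by
        intro k
        rw [Finset.sum_eq_single (-1)]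
        · simp [vectorComb_single]
        · intro j _ hj
          simp [Pi.single_eq_of_ne hj]
        · simp
      refine ⟨⟨0, rot_zero.symm⟩, Pi.single (-1) (Pi.single i 1), by simp, fun k => ?_⟩
      rw [hsum]
      by_cases h : (k : ℕ) < p - 1
      · have hk1 : ((k + 1 : Fin p) : ℕ) = k + 1 := Fin.val_add_one_of_lt' (by omega)
        have hk : k ≠ -1 := by
          rintro rfl
          simp at hk1
        rw [sections_directed_of_lt _ _ h, Pi.single_eq_of_ne hk]
        refine ⟨rootedA_pow_mem_exponentRel _, ?_⟩
        rw [rootedA, rooted_pow]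
        have hpos : 0 < k + 1 := Fin.lt_def.2 (by simp [hk1])
        simp [rooted, extendZero, hk1, rot, hpos]
      · have hk : k = -1 := by
          refine eq_neg_of_add_eq_zero_left (Fin.ext ?_)
          have : (k : ℕ) + 1 = p := by omega
          simp [Fin.val_add, this]
        rw [sections_directed_of_not_lt _ _ h, hk, Pi.single_eq_same]
        refine ⟨directed_mem_exponentRel i, ?_⟩
        simp [extendZero, rot_zero, directed, directedAux]
  | one =>
    refine ⟨⟨0, rot_zero.symm⟩, 0, by simp, fun k => ⟨one_mem_exponentRel, ?_⟩⟩
    simp only [Pi.zero_apply, map_zero, Finset.sum_const_zero, rot_zero]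
    rfl
  | mul y z _ _ hy hz =>
    obtain ⟨⟨c, hc⟩, x, hx, hxs⟩ := hy
    obtain ⟨⟨d, hd⟩, w, hw, hws⟩ := hz
    refine ⟨⟨c + d, ?_⟩, fun k => x (k + Fin.ofNat p d.val) + w k, ?_, fun k => ?_⟩
    · rw [rot_add, ← hc, ← hd]; rfl
    · rw [Finset.sum_add_distrib, hw, Prod.snd_mul, toAdd_mul, ← hx]
      congr 1
      exact Equiv.sum_comp (Equiv.addRight (Fin.ofNat p d.val)) x
    · rw [Prod.fst_mul, sections_mul, hd, rot_apply]
      refine ⟨mul_mem_exponentRel (hxs _).1 (hws k).1, ?_⟩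
      rw [mul_apply, act_nil, (hxs _).2, (hws k).2, ← rot_add, shift, ← Finset.sum_add_distrib]
      simp
  | inv y _ hy =>
    obtain ⟨⟨c, hc⟩, x, hx, hxs⟩ := hy
    refine ⟨⟨-c, ?_⟩, fun k => -x (k + Fin.ofNat p (-c).val), ?_, fun k => ?_⟩
    · rw [rot_neg, ← hc]; rfl
    · rw [Finset.sum_neg_distrib, Prod.snd_inv, toAdd_inv, ← hx]
      congr 1
      exact Equiv.sum_comp (Equiv.addRight (Fin.ofNat p (-c).val)) x
    · rw [Prod.fst_inv, sections_inv, hc, ← rot_neg, rot_apply]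
      refine ⟨inv_mem_exponentRel (hxs _).1, ?_⟩
      rw [root_inv, (hxs _).2, ← rot_neg, shift, ← Finset.sum_neg_distrib]
      simp

/-- The exponent vectors of the elements stabilizing the `n`-th level. -/
def stabExponents (e : Fin r → Fin (p - 1) → ZMod p) (n : ℕ) :
    Submodule (ZMod p) (Fin r → ZMod p) :=
  AddSubgroup.toZModSubmodule p
    { carrier := {s | ∃ g ∈ levelStab p n, (g, ofAdd s) ∈ exponentRel e}
      zero_mem' := ⟨1, one_mem _, one_mem_exponentRel⟩
      add_mem' := by
        rintro s t ⟨g, hg, hs⟩ ⟨h, hh, ht⟩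
        exact ⟨g * h, mul_mem hg hh, mul_mem_exponentRel hs ht⟩
      neg_mem' := by
        rintro s ⟨g, hg, hs⟩
        exact ⟨g⁻¹, inv_mem hg, inv_mem_exponentRel hs⟩ }

/-- The cyclic shift of coordinates. -/
def shiftMap (p : ℕ) [NeZero p] : Module.End (ZMod p) (Fin p → ZMod p) :=
  LinearMap.funLeft (ZMod p) (ZMod p) fun k => k - 1

lemma shiftMap_pow_apply [NeZero p] (m : ℕ) (f : Fin p → ZMod p) (k : Fin p) :
    (shiftMap p ^ m) f k = f (k - Fin.ofNat p m) := by
  induction m generalizing k with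
  | zero => simp [Fin.ofNat]
  | succ m ih =>
    rw [pow_succ', Module.End.mul_apply]
    change (shiftMap p ^ m) f (k - 1) = _
    rw [ih, sub_sub]
    congr 2
    ext
    simp [Fin.val_add, Fin.ofNat, add_comm]

lemma shiftMap_pow_self [NeZero p] : shiftMap p ^ p = 1 := by
  refine LinearMap.ext fun f => funext fun k => ?_
  rw [shiftMap_pow_apply]
  simp [Fin.ofNat]

lemma exists_sections_mem_stabExponents [NeZero p] {n : ℕ} {s : Fin r → ZMod p}
    (hs : s ∈ stabExponents e (n + 2)) :
    ∃ x : Fin p → Fin r → ZMod p, ∑ k, x k = s ∧ (∀ k, x k ∈ stabExponents e (n + 1)) ∧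
      ∑ k : Fin p, (shiftMap p ^ (k : ℕ)) (vectorComb e (x k)) = 0 := by
  obtain ⟨g, hg, hgs⟩ := hs
  obtain ⟨-, x, hx, hxs⟩ := exists_sections_of_mem_exponentRel hgs
  refine ⟨x, hx, fun k => ⟨_, sections_mem_levelStab hg k, (hxs k).1⟩, ?_⟩
  funext k
  have h := (hxs k).2
  rw [root_eq_one_of_mem_levelStab (sections_mem_levelStab hg k)] at h
  simpa [shiftMap_pow_apply] using rot_eq_one_iff.1 h.symm

lemma finrank_stabExponents_le [Fact p.Prime] (he : LinearIndependent (ZMod p) e) (n : ℕ) :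
    Module.finrank (ZMod p) (stabExponents e (n + 1)) ≤ r - n := by
  induction n with
  | zero => simpa using (stabExponents e 1).finrank_le
  | succ n ih =>
    by_cases hV : stabExponents e (n + 1) = ⊥
    · have : stabExponents e (n + 2) = ⊥ := by
        rw [Submodule.eq_bot_iff]
        intro s hs
        obtain ⟨x, rfl, hx, -⟩ := exists_sections_mem_stabExponents hs
        simp only [hV, Submodule.mem_bot] at hx
        simp [hx]
      change Module.finrank (ZMod p) (stabExponents e (n + 2)) ≤ _
      rw [this, finrank_bot]
      exact Nat.zero_le _
    · obtain ⟨U, hU, hsum⟩ := exists_lt_forall_sum_mem (shiftMap p) shiftMap_pow_self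
        (vectorComb e) (vectorComb_injective he) _ hV
      have hle : stabExponents e (n + 2) ≤ U := by
        intro s hs
        obtain ⟨x, rfl, hx, hx0⟩ := exists_sections_mem_stabExponents hs
        exact hsum x hx hx0
      have h1 := Submodule.finrank_lt_finrank_of_lt (lt_of_le_of_lt hle hU)
      change Module.finrank (ZMod p) (stabExponents e (n + 2)) ≤ _
      omega

lemma stabExponents_eq_bot [Fact p.Prime] (he : LinearIndependent (ZMod p) e) :
    stabExponents e (r + 1) = ⊥ := by
  rw [← Submodule.finrank_eq_zero (R := ZMod p)]
  simpa using finrank_stabExponents_le he r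

lemma rootedA_mem_multiGGS : rootedA p ∈ multiGGS p e :=
  Subgroup.subset_closure (Or.inl rfl)

lemma directed_mem_multiGGS (i : Fin r) : directed (e i) ∈ multiGGS p e :=
  Subgroup.subset_closure (Or.inr ⟨i, rfl⟩)

/-- Modulo the commutator subgroup, an element is determined by its exponent vector up to a power
of the rooted generator. -/
lemma exists_abelianization_of_eq [NeZero p] {g : AutT p} {s : Fin r → ZMod p}
    (hg : (g, ofAdd s) ∈ exponentRel e) :
    ∃ (h : g ∈ multiGGS p e) (c : ZMod p), g [] = rot c ∧
      Abelianization.of (⟨g, h⟩ : multiGGS p e) =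
        Abelianization.of ⟨rootedA p, rootedA_mem_multiGGS⟩ ^ c.val *
          ∏ i, Abelianization.of ⟨directed (e i), directed_mem_multiGGS i⟩ ^ (s i).val := by
  suffices H : ∀ y ∈ exponentRel e, ∃ (h : y.1 ∈ multiGGS p e) (c : ZMod p), y.1 [] = rot c ∧
      Abelianization.of (⟨y.1, h⟩ : multiGGS p e) =
        Abelianization.of ⟨rootedA p, rootedA_mem_multiGGS⟩ ^ c.val *
          ∏ i, Abelianization.of ⟨directed (e i), directed_mem_multiGGS i⟩ ^ (toAdd y.2 i).val
    from H _ hg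
  clear hg g s
  have hα : (Abelianization.of (⟨rootedA p, rootedA_mem_multiGGS⟩ : multiGGS p e)) ^ p = 1 := by
    rw [← map_pow]
    exact (congrArg _ (Subtype.ext rootedA_pow_self)).trans (map_one _)
  have hβ : ∀ i, (Abelianization.of (⟨directed (e i), directed_mem_multiGGS i⟩ :
      multiGGS p e)) ^ p = 1 := fun i => by
    rw [← map_pow]
    exact (congrArg _ (Subtype.ext (directed_pow_self (e i)))).trans (map_one _)
  intro y hy
  induction hy using Subgroup.closure_induction with
  | mem y hy =>
    rcases hy with rfl | ⟨i, rfl⟩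
    · refine ⟨rootedA_mem_multiGGS, ((1 : ℕ) : ZMod p), ?_, ?_⟩
      · rw [rot_natCast, pow_one]; rfl
      · rw [pow_val_natCast hα]
        simp
    · refine ⟨directed_mem_multiGGS i, 0, rot_zero.symm, ?_⟩
      rw [Finset.prod_eq_single i]
      · have := pow_val_natCast (hβ i) 1
        simp only [Nat.cast_one, pow_one] at this
        simp [this]
      · intro j _ hj
        simp [Pi.single_eq_of_ne hj]
      · simp
  | one => exact ⟨one_mem _, 0, rot_zero.symm, by
      simp only [Prod.snd_one, toAdd_one, Pi.zero_apply, ZMod.val_zero, pow_zero,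
        Finset.prod_const_one, mul_one]
      exact map_one (Abelianization.of (G := multiGGS p e))⟩
  | mul y z _ _ hy hz =>
    obtain ⟨hy, c, hc, hyc⟩ := hy
    obtain ⟨hz, d, hd, hzd⟩ := hz
    refine ⟨mul_mem hy hz, c + d, by rw [rot_add, ← hc, ← hd]; rfl, ?_⟩
    have : Abelianization.of (⟨(y * z).1, mul_mem hy hz⟩ : multiGGS p e) =
        Abelianization.of ⟨y.1, hy⟩ * Abelianization.of ⟨z.1, hz⟩ := by rw [← map_mul]; rfl
    rw [this, hyc, hzd, mul_mul_mul_comm, ← pow_val_add hα, ← Finset.prod_mul_distrib]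
    simp only [Prod.snd_mul, toAdd_mul, Pi.add_apply, pow_val_add (hβ _)]
  | inv y _ hy =>
    obtain ⟨hy, c, hc, hyc⟩ := hy
    refine ⟨inv_mem hy, -c, by rw [rot_neg, ← hc]; rfl, ?_⟩
    have : Abelianization.of (⟨y⁻¹.1, inv_mem hy⟩ : multiGGS p e) =
        (Abelianization.of ⟨y.1, hy⟩)⁻¹ := by rw [← map_inv]; rfl
    rw [this, hyc, mul_inv, ← pow_val_neg hα, ← Finset.prod_inv_distrib]
    simp only [Prod.snd_inv, toAdd_inv, Pi.neg_apply, pow_val_neg (hβ _)]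

end Exponents

end AutT

end TreeAut

open TreeAut AutT Subgroup

/-- For a multi-GGS-group `G` with `r` directed generators,
`st_G(r+1) ≤ G'`. -/
theorem stab_succ_le_derived
    (p r : ℕ) (hp : p.Prime) (hpodd : Odd p) (hr : 1 ≤ r)
    (e : Fin r → Fin (p - 1) → ZMod p) (he : LinearIndependent (ZMod p) e) :
    (levelStab p (r + 1) ⊓ multiGGS p e : Subgroup (AutT p)) ≤ ⁅multiGGS p e, multiGGS p e⁆ := by
  have : Fact p.Prime := ⟨hp⟩
  rintro g ⟨hst, hg⟩
  obtain ⟨s, hs⟩ := exists_mem_exponentRel hg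
  have hs0 : s ∈ stabExponents e (r + 1) := ⟨g, hst, hs⟩
  rw [stabExponents_eq_bot he, Submodule.mem_bot] at hs0
  obtain ⟨h, c, hc, hab⟩ := exists_abelianization_of_eq hs
  rw [root_eq_one_of_mem_levelStab hst] at hc
  rw [rot_eq_one_iff.1 hc.symm, hs0] at hab
  have hmem : (⟨g, h⟩ : multiGGS p e) ∈ commutator (multiGGS p e) := by
    rw [← Abelianization.ker_of, MonoidHom.mem_ker]
    simpa using hab
  have := Subgroup.mem_map_of_mem (multiGGS p e).subtype hmem
  rwa [commutator_def, Subgroup.map_commutator, ← MonoidHom.range_eq_map,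
    Subgroup.range_subtype] at this
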